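/- Let ν ≥ 1 and μ ≥ 1. Every 2μ-linear O(2ν)-invariant polynomial over an algebraically closed field of characteristic 2, written in the coordinates t_r = x_r, s_r = x_r + y_r, has multiplicity at least min(μ, ν) in the s variables. -/

import Mathlib

open MvPolynomial

/-- The standard quadratic form `x₁y₁ + ⋯ + x_ν y_ν (+ z²)` on `n`-space. -/
def stdQ (F : Type*) [CommRing F] (n : ℕ) (v : Fin n → F) : F :=
  (∑ r : Fin (n/2), v ⟨2*r.1, by have := r.2; omega⟩ * v ⟨2*r.1+1, by have := r.2; omega⟩)
  + if h : n % 2 = 1 then (v ⟨n-1, by omega⟩)^2 else 0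


/-- The action of a matrix `g` on polynomials in the coordinates of `m` vectors,
substituting `v ↦ g v` in each vector variable. -/
noncomputable def substAct {k : Type*} [CommSemiring k] {m n : ℕ}
    (g : Matrix (Fin n) (Fin n) k) :
    MvPolynomial (Fin m × Fin n) k →ₐ[k] MvPolynomial (Fin m × Fin n) k :=
  MvPolynomial.aeval fun ic => ∑ c : Fin n, MvPolynomial.C (g ic.2 c) * MvPolynomial.X (ic.1, c)


/-- `p` is `m`-linear: each monomial has degree exactly 1 in the variables of each vector. -/
def IsMultilinear {k : Type*} [CommSemiring k] {m n : ℕ}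
    (p : MvPolynomial (Fin m × Fin n) k) : Prop :=
  ∀ d ∈ p.support, ∀ i : Fin m, (∑ c : Fin n, d (i, c)) = 1


/-- Membership in the orthogonal group `O(n)`: an invertible matrix preserving `stdQ`. -/
def inO {k : Type*} [CommRing k] {n : ℕ} (g : Matrix (Fin n) (Fin n) k) : Prop :=
  IsUnit g.det ∧ ∀ v : Fin n → k, stdQ k n (g.mulVec v) = stdQ k n v


/-- Rewriting a polynomial in the coordinates `t_r = x_r`, `s_r = x_r + y_r` (characteristic 2):
substitute `x_r ↦ t_r` and `y_r ↦ t_r + s_r`, where coordinate `2r` now stands for `t_r` and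
coordinate `2r+1` stands for `s_r`. -/
noncomputable def toTS {k : Type*} [CommSemiring k] {m n : ℕ} :
    MvPolynomial (Fin m × Fin n) k →ₐ[k] MvPolynomial (Fin m × Fin n) k :=
  MvPolynomial.aeval fun ic : Fin m × Fin n =>
    if ic.2.1 % 2 = 0 then MvPolynomial.X ic
    else MvPolynomial.X (ic.1, ⟨ic.2.1 - 1, by have := ic.2.2; omega⟩) + MvPolynomial.X ic


/-- The split quadratic form on `(k²)^ν`. -/
def SM.Q {k : Type*} [Field k] {ν : ℕ} (v : Fin ν → k × k) : k := ∑ r, (v r).1 * (v r).2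

/-- A multilinear form is invariant under involutions / isometries of `SM.Q`. -/
def SM.Inv {k : Type*} [Field k] {ν m : ℕ}
    (F : MultilinearMap k (fun _ : Fin m => (Fin ν → k × k)) k) : Prop :=
  ∀ T S : (Fin ν → k × k) →ₗ[k] (Fin ν → k × k), (∀ v, T (S v) = v) →
    (∀ v, SM.Q (T v) = SM.Q v) → ∀ w, F (fun i => T (w i)) = F w

/-- The map changing plane `r` by a linear map. -/
def SM.plane {k : Type*} [Field k] {ν : ℕ} (r : Fin ν) (h : k × k →ₗ[k] k × k) :
    (Fin ν → k × k) →ₗ[k] (Fin ν → k × k) where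
  toFun v s := if s = r then h (v s) else v s
  map_add' v w := by ext s <;> by_cases hs : s = r <;> simp [hs]
  map_smul' c v := by ext s <;> by_cases hs : s = r <;> simp [hs]

theorem SM.plane_apply {k : Type*} [Field k] {ν : ℕ} (r : Fin ν) (h : k × k →ₗ[k] k × k)
    (v : Fin ν → k × k) (s : Fin ν) :
    SM.plane r h v s = if s = r then h (v s) else v s := rfl

theorem SM.plane_single_same {k : Type*} [Field k] {ν : ℕ} (r : Fin ν) (h : k × k →ₗ[k] k × k)
    (x : k × k) : SM.plane r h (Pi.single r x) = Pi.single r (h x) := by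
  funext s
  rw [SM.plane_apply]
  by_cases hs : s = r
  · subst hs; simp
  · simp [hs]

theorem SM.plane_single_ne {k : Type*} [Field k] {ν : ℕ} {r t : Fin ν} (hrt : t ≠ r)
    (h : k × k →ₗ[k] k × k)
    (x : k × k) : SM.plane r h (Pi.single t x) = Pi.single t x := by
  funext s
  rw [SM.plane_apply]
  by_cases hs : s = r
  · subst hs; simp [hrt.symm]
  · simp [hs]

theorem SM.inv_plane {k : Type*} [Field k] {ν m : ℕ}
    {F : MultilinearMap k (fun _ : Fin m => (Fin ν → k × k)) k} (hF : SM.Inv F)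
    (r : Fin ν) (h h' : k × k →ₗ[k] k × k) (hh : ∀ x, h (h' x) = x)
    (hq : ∀ x, (h x).1 * (h x).2 = x.1 * x.2) (w : Fin m → (Fin ν → k × k)) :
    F (fun i => SM.plane r h (w i)) = F w := by
  apply hF _ (SM.plane r h')
  · intro v
    funext s
    rw [SM.plane_apply, SM.plane_apply]
    split_ifs <;> simp [hh]
  · intro v
    unfold SM.Q
    refine Finset.sum_congr rfl fun s _ => ?_
    rw [SM.plane_apply]
    split_ifs
    · exact hq _
    · rfl

/-- Lemma A. -/
theorem SM.lemA {k : Type*} [Field k] [CharP k 2] {ν m : ℕ}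
    {F : MultilinearMap k (fun _ : Fin m => (Fin ν → k × k)) k} (hF : SM.Inv F)
    (r : Fin ν) (w : Fin m → (Fin ν → k × k))
    (hw : ∀ i, (w i r).1 = (w i r).2) (i : Fin m) (hi : w i = Pi.single r (1, 1)) :
    F w = 0 := by
  let sw : k × k →ₗ[k] k × k := (LinearEquiv.prodComm k k k).toLinearMap
  have h1 : F w = F (Function.update w i (Pi.single r (1, 0)))
      + F (Function.update w i (Pi.single r (0, 1))) := by
    rw [← F.map_update_add, ← Pi.single_add]
    simp [← hi]
  have h2 := SM.inv_plane hF r sw sw (fun x => by simp [sw]) (fun x => by simp [sw, mul_comm])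
    (Function.update w i (Pi.single r (1, 0)))
  have h3 : (fun j => SM.plane r sw (Function.update w i (Pi.single r ((1 : k), (0 : k))) j))
      = Function.update w i (Pi.single r (0, 1)) := by
    funext j
    by_cases hj : j = i
    · subst hj
      simp [SM.plane_single_same, sw]
    · rw [Function.update_of_ne hj, Function.update_of_ne hj]
      funext s
      rw [SM.plane_apply]
      split_ifs with hs
      · subst hs
        ext <;> simp [sw, hw]
      · rfl
  rw [h3] at h2
  rw [h1, h2]
  exact CharTwo.add_self_eq_zero _

/-- The special isometry mixing planes `r` and `t`. -/
def SM.mix {k : Type*} [Field k] {ν : ℕ} (r t : Fin ν) :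
    (Fin ν → k × k) →ₗ[k] (Fin ν → k × k) where
  toFun v s := if s = r then ((v r).1, (v r).2 + (v r).1 + (v t).1 + (v t).2)
    else if s = t then ((v t).1 + (v r).1, (v t).2 + (v r).1) else v s
  map_add' v w := by
    funext s
    by_cases hs : s = r
    · simp [hs]; ring
    · by_cases ht : s = t
      · subst ht; simp [hs]; constructor <;> ring
      · simp [hs, ht]
  map_smul' c v := by
    funext s
    by_cases hs : s = r
    · simp [hs]; ring
    · by_cases ht : s = t
      · subst ht; simp [hs]; constructor <;> ring
      · simp [hs, ht]

theorem SM.mix_apply {k : Type*} [Field k] {ν : ℕ} (r t : Fin ν) (v : Fin ν → k × k)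
    (s : Fin ν) : SM.mix r t v s = if s = r then ((v r).1, (v r).2 + (v r).1 + (v t).1 + (v t).2)
    else if s = t then ((v t).1 + (v r).1, (v t).2 + (v r).1) else v s := rfl

theorem SM.inv_mix {k : Type*} [Field k] [CharP k 2] {ν m : ℕ}
    {F : MultilinearMap k (fun _ : Fin m => (Fin ν → k × k)) k} (hF : SM.Inv F)
    (r t : Fin ν) (hrt : r ≠ t) (w : Fin m → (Fin ν → k × k)) :
    F (fun i => SM.mix r t (w i)) = F w := by
  have h2 : (2 : k) = 0 := CharTwo.two_eq_zero
  apply hF _ (SM.mix r t)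
  · intro v
    funext s
    by_cases hs : s = r
    · subst hs
      simp only [SM.mix_apply, if_true, if_neg hrt.symm]
      ext
      · rfl
      · simp only
        linear_combination (2 * (v s).1 + (v t).1 + (v t).2) * h2
    · by_cases ht : s = t
      · subst ht
        simp only [SM.mix_apply, if_true, if_neg hrt.symm]
        ext
        · simp only
          linear_combination ((v r).1) * h2
        · simp only
          linear_combination ((v r).1) * h2
      · simp [SM.mix_apply, hs, ht]
  · intro v
    rw [← sub_eq_zero]
    unfold SM.Q
    rw [← Finset.sum_sub_distrib, Finset.sum_eq_add r t hrt]
    · simp only [SM.mix_apply, if_true, if_neg hrt.symm]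
      linear_combination ((v r).1 ^ 2 + (v r).1 * (v t).1 + (v r).1 * (v t).2) * h2
    · rintro s - ⟨hs, ht⟩
      simp [SM.mix_apply, hs, ht]
    · simp
    · simp

theorem SM.exists_scalar (k : Type*) [Field k] [Infinite k] (N : ℕ) (hN : 0 < N) :
    ∃ l : k, l ≠ 0 ∧ l ^ N ≠ 1 := by
  have hP : (Polynomial.X * (Polynomial.X ^ N - Polynomial.C 1) : Polynomial k) ≠ 0 :=
    mul_ne_zero Polynomial.X_ne_zero (Polynomial.X_pow_sub_C_ne_zero hN 1)
  by_contra! hcon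
  apply hP
  apply Polynomial.funext
  intro l
  by_cases hl : l = 0
  · simp [hl]
  · simp [hcon l hl]

/-- Standard vectors: `false ↦ a_r`, `true ↦ b_r`. -/
def SM.vec (k : Type*) [Field k] {ν : ℕ} (c : Fin ν × Bool) : Fin ν → k × k :=
  Pi.single c.1 (if c.2 then (0, 1) else (1, 1))

theorem SM.core {k : Type*} [Field k] [Infinite k] [CharP k 2] {ν m : ℕ}
    {F : MultilinearMap k (fun _ : Fin m => (Fin ν → k × k)) k} (hF : SM.Inv F)
    (c : Fin m → Fin ν × Bool)
    (h1 : (Finset.univ.filter fun i => (c i).2 = true).card < ν)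
    (h2 : 2 * (Finset.univ.filter fun i => (c i).2 = true).card < m) :
    F (fun i => SM.vec k (c i)) = 0 := by
  classical
  -- a plane without b
  obtain ⟨t, ht⟩ : ∃ t : Fin ν, ∀ i, (c i).1 = t → (c i).2 = false := by
    by_contra! hcon
    have : (Finset.univ : Finset (Fin ν)) ⊆
        (Finset.univ.filter fun i => (c i).2 = true).image (fun i => (c i).1) := by
      intro t _
      obtain ⟨i, hi, hi'⟩ := hcon t
      simp only [Finset.mem_image, Finset.mem_filter, Finset.mem_univ, true_and]
      exact ⟨i, by simpa using hi', hi⟩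
    have h3 := (Finset.card_le_card this).trans Finset.card_image_le
    rw [Finset.card_univ, Fintype.card_fin] at h3
    omega
  by_cases hta : ∃ i, (c i).1 = t
  · obtain ⟨i, hi⟩ := hta
    refine SM.lemA hF t _ ?_ i ?_
    · intro j
      by_cases hj : (c j).1 = t
      · simp [SM.vec, hj, ht j hj]
      · simp [SM.vec, Pi.single_eq_of_ne (Ne.symm hj)]
    · simp [SM.vec, hi, ht i hi]
  push Not at hta
  -- a plane with more a than b
  obtain ⟨r, hr⟩ : ∃ r : Fin ν,
      (Finset.univ.filter fun i => c i = (r, true)).card <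
      (Finset.univ.filter fun i => c i = (r, false)).card := by
    by_contra! hcon
    have hs : ∀ b : Bool, (Finset.univ.filter fun i => (c i).2 = b).card
        = ∑ r : Fin ν, (Finset.univ.filter fun i => c i = (r, b)).card := by
      intro b
      rw [Finset.card_eq_sum_card_fiberwise (f := fun i => (c i).1) (t := Finset.univ)
        (by intro x _; simp)]
      refine Finset.sum_congr rfl fun r _ => ?_
      congr 1
      ext i
      simp [Prod.ext_iff, and_comm]
    have h4 := Finset.sum_le_sum (s := Finset.univ) fun r _ => hcon r
    rw [← hs, ← hs] at h4
    have h5 := Finset.card_filter_add_card_filter_not (s := (Finset.univ : Finset (Fin m)))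
      (fun i => (c i).2 = true)
    simp only [Bool.not_eq_true, Finset.card_univ, Fintype.card_fin] at h5
    omega
  have hrt : r ≠ t := by
    rintro rfl
    have : (Finset.univ.filter fun i => c i = (r, false)).card = 0 := by
      rw [Finset.card_eq_zero, Finset.filter_eq_empty_iff]
      intro i _ hi
      exact hta i (by rw [hi])
    omega
  rw [← SM.inv_mix hF r t hrt]
  let A : Fin m → (Fin ν → k × k) := fun i =>
    if c i = (r, false) then Pi.single r (1, 0) else SM.vec k (c i)
  let B : Fin m → (Fin ν → k × k) := fun i =>
    if c i = (r, false) then Pi.single t (1, 1) else 0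
  have hAB : (fun i => SM.mix r t (SM.vec k (c i))) = A + B := by
    funext i
    have hne := hta i
    rw [Pi.add_apply]
    rcases hc : c i with ⟨u, b⟩
    rw [hc] at hne
    simp only at hne
    funext s
    rw [SM.mix_apply]
    simp only [A, B, hc]
    have h2 : (1 : k) + 1 = 0 := CharTwo.add_self_eq_zero _
    by_cases hu : u = r
    · subst hu
      by_cases hs : s = u
      · subst hs
        cases b <;> simp [SM.vec, hrt, hrt.symm, h2]
      · by_cases hst : s = t
        · subst hst
          cases b <;> simp [SM.vec, hrt, hrt.symm, h2]
        · cases b <;> simp [SM.vec, hs, hst]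
    · have hur : r ≠ u := fun h => hu h.symm
      have hut : t ≠ u := fun h => hne h.symm
      by_cases hs : s = r
      · subst hs
        simp [SM.vec, hu, hur, hut]
      · by_cases hst : s = t
        · subst hst
          simp [SM.vec, hu, hur, hut, hs]
        · simp [SM.vec, hs, hst, hu]
  have hA : ∀ i, A i t = 0 := by
    intro i
    simp only [A]
    split_ifs
    · simp [hrt.symm]
    · simp [SM.vec, Pi.single_eq_of_ne (Ne.symm (hta i))]
  rw [hAB, F.map_add_univ]
  refine Finset.sum_eq_zero fun s _ => ?_
  by_cases hs : s = Finset.univ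
  · subst hs
    rw [Finset.piecewise_univ]
    obtain ⟨l, hl0, hl1⟩ := SM.exists_scalar k _ (Nat.sub_pos_of_lt hr)
    let D : k → k → (k × k →ₗ[k] k × k) := fun a b =>
      LinearMap.prodMap (a • LinearMap.id) (b • LinearMap.id)
    have h6 := SM.inv_plane hF r (D l l⁻¹) (D l⁻¹ l)
      (fun x => by simp [D, hl0])
      (fun x => by simp [D]; field_simp) A
    have h7 : (fun i => SM.plane r (D l l⁻¹) (A i)) = fun i =>
        ((if c i = (r, false) then l else 1) * (if c i = (r, true) then l⁻¹ else 1)) • A i := by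
      funext i
      simp only [A]
      rcases hc : c i with ⟨u, b⟩
      by_cases hu : u = r
      · subst hu
        cases b
        · simp only [if_true, SM.plane_single_same]
          simp [D, ← Pi.single_smul]
        · simp [SM.vec, SM.plane_single_same, D, ← Pi.single_smul]
      · simp [SM.vec, hu, SM.plane_single_ne]
    rw [h7, F.map_smul_univ, Finset.prod_mul_distrib, Finset.prod_ite, Finset.prod_ite] at h6
    simp only [Finset.prod_const, one_pow, mul_one] at h6
    by_contra hne
    rw [smul_eq_mul] at h6
    have h8 := mul_right_cancel₀ hne (h6.trans (one_mul _).symm)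
    apply hl1
    rw [pow_sub₀ l hl0 hr.le, ← inv_pow]
    exact h8
  · obtain ⟨i, hi⟩ : ∃ i, i ∉ s := by
      by_contra! h
      exact hs (Finset.eq_univ_iff_forall.2 h)
    by_cases hc : c i = (r, false)
    · refine SM.lemA hF t _ ?_ i ?_
      · intro j
        by_cases hj : j ∈ s
        · simp [hj, hA]
        · simp only [Finset.piecewise_eq_of_notMem _ _ _ hj, B]
          split_ifs <;> simp
      · simp [hi, B, hc]
    · apply F.map_coord_zero i
      simp [hi, B, hc]

/-- The linear form attached to row `i` of an exponent. -/
noncomputable def SM.rowForm (k : Type*) [Field k] {m n : ℕ} (d : Fin m × Fin n →₀ ℕ) (i : Fin m) :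
    (Fin n → k) →ₗ[k] k := ∑ c, (d (i, c) : k) • LinearMap.proj c

theorem SM.exists_of_sum_eq_one {n : ℕ} (e : Fin n → ℕ) (h : ∑ c, e c = 1) :
    ∃ c, e = Pi.single c 1 := by
  obtain ⟨c, hc⟩ : ∃ c, e c ≠ 0 := by
    by_contra! hcon
    simp [hcon] at h
  refine ⟨c, ?_⟩
  rw [← Finset.add_sum_erase _ _ (Finset.mem_univ c)] at h
  have h0 : ∑ x ∈ Finset.univ.erase c, e x = 0 := by omega
  rw [Finset.sum_eq_zero_iff] at h0
  funext x
  by_cases hx : x = c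
  · subst hx; simp; omega
  · simp [hx, h0 x (by simp [hx])]

theorem SM.rowForm_apply (k : Type*) [Field k] {m n : ℕ} (d : Fin m × Fin n →₀ ℕ) (i : Fin m)
    (h : ∑ c, d (i, c) = 1) (v : Fin n → k) :
    SM.rowForm k d i v = ∏ c, v c ^ d (i, c) := by
  obtain ⟨c, hc⟩ := SM.exists_of_sum_eq_one (fun c => d (i, c)) h
  have hc' : ∀ x, d (i, x) = (Pi.single c 1 : Fin n → ℕ) x := fun x => congrFun hc x
  simp only [SM.rowForm, hc', LinearMap.sum_apply, LinearMap.smul_apply, LinearMap.proj_apply]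
  rw [Finset.sum_eq_single c, Finset.prod_eq_single c]
  · simp
  · intro b _ hb; simp [hb]
  · simp
  · intro b _ hb; simp [hb]
  · simp

/-- The multilinear map of a multilinear polynomial. -/
noncomputable def SM.toMulti {k : Type*} [Field k] {m n : ℕ}
    (p : MvPolynomial (Fin m × Fin n) k) :
    MultilinearMap k (fun _ : Fin m => (Fin n → k)) k :=
  ∑ d ∈ p.support, coeff d p •
    (MultilinearMap.mkPiAlgebra k (Fin m) k).compLinearMap (fun i => SM.rowForm k d i)

theorem SM.toMulti_apply {k : Type*} [Field k] {m n : ℕ}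
    (p : MvPolynomial (Fin m × Fin n) k) (hp : IsMultilinear p) (w : Fin m → (Fin n → k)) :
    SM.toMulti p w = eval (fun ic => w ic.1 ic.2) p := by
  rw [SM.toMulti, MultilinearMap.sum_apply, eval_eq']
  refine Finset.sum_congr rfl fun d hd => ?_
  rw [Fintype.prod_prod_type]
  simp only [MultilinearMap.smul_apply, MultilinearMap.compLinearMap_apply,
    MultilinearMap.mkPiAlgebra_apply, smul_eq_mul]
  congr 1
  refine Finset.prod_congr rfl fun i _ => ?_
  rw [SM.rowForm_apply k d i (hp d hd i)]

theorem SM.eval_substAct {k : Type*} [Field k] {m n : ℕ} (g : Matrix (Fin n) (Fin n) k)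
    (p : MvPolynomial (Fin m × Fin n) k) (w : Fin m → (Fin n → k)) :
    eval (fun ic => w ic.1 ic.2) (substAct g p)
      = eval (fun ic => g.mulVec (w ic.1) ic.2) p := by
  rw [substAct, aeval_def, eval₂_eq', map_sum, eval_eq']
  refine Finset.sum_congr rfl fun d _ => ?_
  simp [Matrix.mulVec, dotProduct, algebraMap_eq]

/-- weight counting the variables of vector `i`. -/
def SM.wt {m n : ℕ} (i : Fin m) : Fin m × Fin n → ℕ := fun ic => if ic.1 = i then 1 else 0

theorem SM.weight_wt {m n : ℕ} (i : Fin m) (d : Fin m × Fin n →₀ ℕ) :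
    Finsupp.weight (SM.wt i) d = ∑ c, d (i, c) := by
  rw [Finsupp.weight_apply, Finsupp.sum_fintype _ _ (by simp), Fintype.sum_prod_type,
    Finset.sum_eq_single i]
  · simp [SM.wt]
  · intro j _ hj; simp [SM.wt, hj]
  · simp

theorem SM.toTS_multilinear {k : Type*} [Field k] {m n : ℕ}
    (p : MvPolynomial (Fin m × Fin n) k) (hp : IsMultilinear p) : IsMultilinear (toTS p) := by
  intro d hd i
  have key : IsWeightedHomogeneous (SM.wt i) (toTS p) 1 := by
    rw [toTS, aeval_def, eval₂_eq']
    refine IsWeightedHomogeneous.sum _ _ _ fun e he => ?_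
    have h0 : ∀ q : MvPolynomial (Fin m × Fin n) k, IsWeightedHomogeneous (SM.wt i) q 1 →
        IsWeightedHomogeneous (SM.wt i) (C (coeff e p) * q) 1 := fun q hq => by
      have := IsWeightedHomogeneous.mul (isWeightedHomogeneous_C (SM.wt i) (coeff e p)) hq
      rwa [zero_add] at this
    refine h0 _ ?_
    have h1 : 1 = ∑ ic, e ic • SM.wt i ic := by
      rw [← hp e he i, ← SM.weight_wt, Finsupp.weight_apply, Finsupp.sum_fintype _ _ (by simp)]
    refine Eq.subst (motive := fun N => IsWeightedHomogeneous (SM.wt i) _ N) h1.symm ?_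
    refine IsWeightedHomogeneous.prod _ _ _ fun ic _ => ?_
    refine IsWeightedHomogeneous.pow ?_ _
    split_ifs
    · exact isWeightedHomogeneous_X _ _ _
    · refine IsWeightedHomogeneous.add ?_ (isWeightedHomogeneous_X _ _ _)
      exact isWeightedHomogeneous_X k (SM.wt i) (ic.1, _)
  rw [← SM.weight_wt]
  exact key (mem_support_iff.1 hd)

theorem SM.coeff_eq_eval {k : Type*} [Field k] {m n : ℕ}
    (p : MvPolynomial (Fin m × Fin n) k) (hp : IsMultilinear p) (d : Fin m × Fin n →₀ ℕ)
    (σ : Fin m → Fin n) (hd : ∀ i c, d (i, c) = (Pi.single (σ i) 1 : Fin n → ℕ) c) :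
    eval (fun ic => (Pi.single (σ ic.1) 1 : Fin n → k) ic.2) p = coeff d p := by
  rw [eval_eq', Finset.sum_eq_single d]
  · rw [Finset.prod_eq_one, mul_one]
    rintro ⟨i, c⟩ _
    rw [hd]
    by_cases hc : c = σ i
    · subst hc; simp
    · simp [hc]
  · intro e he hed
    have : ∃ i, e (i, σ i) = 0 := by
      by_contra! hcon
      apply hed
      ext ⟨i, c⟩
      obtain ⟨x, hx⟩ := SM.exists_of_sum_eq_one (fun c => e (i, c)) (hp e he i)
      have hx' : ∀ y, e (i, y) = (Pi.single x 1 : Fin n → ℕ) y := fun y => congrFun hx y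
      have : σ i = x := by
        by_contra hne
        apply hcon i
        rw [hx', Pi.single_eq_of_ne hne]
      rw [hd, hx', this]
    obtain ⟨i, hi⟩ := this
    obtain ⟨x, hx⟩ := SM.exists_of_sum_eq_one (fun c => e (i, c)) (hp e he i)
    have hx' : ∀ y, e (i, y) = (Pi.single x 1 : Fin n → ℕ) y := fun y => congrFun hx y
    have hne : x ≠ σ i := by
      rintro rfl
      rw [hx'] at hi
      simp at hi
    rw [Finset.prod_eq_zero (Finset.mem_univ (i, x)), mul_zero]
    rw [hx']
    simp [hne]
  · intro h
    rw [notMem_support_iff.1 h, zero_mul]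

/-- Coordinates: pairs `(x_r, y_r)` interleaved. -/
def SM.phi (k : Type*) [Field k] (ν : ℕ) : (Fin ν → k × k) ≃ₗ[k] (Fin (2 * ν) → k) where
  toFun v c := if c.1 % 2 = 0 then (v ⟨c.1 / 2, by have := c.2; omega⟩).1
    else (v ⟨c.1 / 2, by have := c.2; omega⟩).2
  map_add' v w := by funext c; simp only [Pi.add_apply]; split_ifs <;> rfl
  map_smul' a v := by funext c; simp only [Pi.smul_apply]; split_ifs <;> rfl
  invFun u r := (u ⟨2 * r.1, by have := r.2; omega⟩, u ⟨2 * r.1 + 1, by have := r.2; omega⟩)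
  left_inv v := by
    funext r
    have h1 : (2 * r.1 + 1) / 2 = r.1 := by omega
    ext <;> simp [Nat.add_mod, h1]
  right_inv u := by
    funext c
    simp only
    split_ifs with h
    · congr 1; ext; simp only; omega
    · congr 1; ext; simp only; omega

theorem SM.phi_apply (k : Type*) [Field k] (ν : ℕ) (v : Fin ν → k × k) (c : Fin (2 * ν)) :
    SM.phi k ν v c = if c.1 % 2 = 0 then (v ⟨c.1 / 2, by have := c.2; omega⟩).1
    else (v ⟨c.1 / 2, by have := c.2; omega⟩).2 := rfl

theorem SM.stdQ_phi (k : Type*) [Field k] (ν : ℕ) (v : Fin ν → k × k) :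
    stdQ k (2 * ν) (SM.phi k ν v) = SM.Q v := by
  have hn : 2 * ν / 2 = ν := by omega
  have h0 : ¬ (2 * ν % 2 = 1) := by omega
  rw [stdQ, dif_neg h0, add_zero, SM.Q]
  refine Fintype.sum_equiv (finCongr hn) _ _ fun r => ?_
  rw [SM.phi_apply, SM.phi_apply, if_pos (by simp), if_neg (by simp [Nat.add_mod])]
  have h1 : (2 * r.1 + 1) / 2 = r.1 := by omega
  have h2 : (2 * r.1) / 2 = r.1 := by omega
  simp only [h1, h2]
  rfl

/-- For `ν ≥ 1`, `μ ≥ 1`, every `2μ`-linear `O(2ν)`-invariant polynomial over an algebraically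
closed field of characteristic 2, written in the coordinates `t_r = x_r`, `s_r = x_r + y_r`,
has multiplicity at least `min μ ν` in the `s` variables (the odd coordinates). -/
theorem multilinear_invariant_s_multiplicity
    (k : Type*) [Field k] [IsAlgClosed k] [CharP k 2]
    (ν μ : ℕ) (hν : 1 ≤ ν) (hμ : 1 ≤ μ)
    (p : MvPolynomial (Fin (2*μ) × Fin (2*ν)) k) (hlin : IsMultilinear p)
    (hinv : ∀ g : Matrix (Fin (2*ν)) (Fin (2*ν)) k, inO g → substAct g p = p) :
    ∀ d ∈ (toTS p).support,
      min μ ν ≤ ∑ i : Fin (2*μ), ∑ c : Fin (2*ν), if c.1 % 2 = 1 then d (i, c) else 0 := by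
  intro d hd
  by_contra! hlt
  have : Infinite k := IsAlgClosed.instInfinite
  have hTS := SM.toTS_multilinear p hlin
  have hex : ∀ i, ∃ c, (fun c => d (i, c)) = Pi.single c 1 := fun i =>
    SM.exists_of_sum_eq_one _ (hTS d hd i)
  choose σ hσ using hex
  have hσ' : ∀ i c, d (i, c) = (Pi.single (σ i) 1 : Fin (2*ν) → ℕ) c :=
    fun i c => congrFun (hσ i) c
  -- the invariant multilinear form
  let F := (SM.toMulti p).compLinearMap (fun _ => (SM.phi k ν).toLinearMap)
  have hF : SM.Inv F := by
    intro T S hTS hQ w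
    let T' := (SM.phi k ν).toLinearMap ∘ₗ T ∘ₗ (SM.phi k ν).symm.toLinearMap
    let S' := (SM.phi k ν).toLinearMap ∘ₗ S ∘ₗ (SM.phi k ν).symm.toLinearMap
    have hTS' : T' ∘ₗ S' = LinearMap.id := by
      refine LinearMap.ext fun v => ?_
      simp [T', S', hTS]
    have hO : inO (LinearMap.toMatrix' T') := by
      constructor
      · rw [LinearMap.det_toMatrix']
        refine IsUnit.of_mul_eq_one (LinearMap.det S') ?_
        rw [← LinearMap.det_comp, hTS', LinearMap.det_id]
      · intro v
        rw [LinearMap.toMatrix'_mulVec]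
        obtain ⟨u, rfl⟩ := (SM.phi k ν).surjective v
        simp only [T', LinearMap.comp_apply, LinearEquiv.coe_coe, LinearEquiv.symm_apply_apply]
        rw [SM.stdQ_phi, SM.stdQ_phi, hQ]
    have h1 := SM.eval_substAct (LinearMap.toMatrix' T') p (fun i => SM.phi k ν (w i))
    rw [hinv _ hO] at h1
    simp only [F, MultilinearMap.compLinearMap_apply, LinearEquiv.coe_coe]
    rw [SM.toMulti_apply p hlin, SM.toMulti_apply p hlin, h1]
    simp [LinearMap.toMatrix'_mulVec, T']
  let c : Fin (2*μ) → Fin ν × Bool := fun i =>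
    (⟨(σ i).1 / 2, by have := (σ i).2; omega⟩, decide ((σ i).1 % 2 = 1))
  have hcount : (∑ i : Fin (2*μ), ∑ c : Fin (2*ν), if c.1 % 2 = 1 then d (i, c) else 0)
      = (Finset.univ.filter fun i => (c i).2 = true).card := by
    rw [Finset.card_filter]
    refine Finset.sum_congr rfl fun i _ => ?_
    rw [Finset.sum_eq_single (σ i)]
    · simp [hσ', c]
    · intro x _ hx
      simp [hσ', hx]
    · simp
  rw [hcount, lt_min_iff] at hlt
  have hzero := SM.core hF c hlt.2 (by omega)
  rw [mem_support_iff] at hd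
  apply hd
  rw [← SM.coeff_eq_eval (toTS p) hTS d σ hσ', ← hzero]
  simp only [F, MultilinearMap.compLinearMap_apply, LinearEquiv.coe_coe]
  rw [SM.toMulti_apply p hlin, toTS, aeval_def, eval₂_eq', map_sum, eval_eq']
  refine Finset.sum_congr rfl fun e _ => ?_
  rw [map_mul, map_prod, algebraMap_eq, eval_C]
  congr 1
  refine Finset.prod_congr rfl fun ic _ => ?_
  rw [map_pow]
  congr 1
  rcases ic with ⟨i, x⟩
  rw [SM.phi_apply]
  simp only [SM.vec, c]
  have hx2 := x.2
  by_cases hx : x.1 % 2 = 0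
  · rw [if_pos hx, if_pos hx, eval_X]
    simp only [Pi.single_apply, Fin.ext_iff]
    by_cases h1 : x.1 / 2 = (σ i).1 / 2
    · by_cases h2 : (σ i).1 % 2 = 1
      · have : ¬ (x.1 = (σ i).1) := by omega
        simp [h1, h2, this]
      · have : x.1 = (σ i).1 := by omega
        simp [h2, this]
    · have : ¬ (x.1 = (σ i).1) := by omega
      simp [h1, this]
  · rw [if_neg hx, if_neg hx, map_add, eval_X, eval_X]
    simp only [Pi.single_apply, Fin.ext_iff]
    by_cases h1 : x.1 / 2 = (σ i).1 / 2
    · by_cases h2 : (σ i).1 % 2 = 1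
      · have h3 : x.1 = (σ i).1 := by omega
        have h4 : ¬ (x.1 - 1 = (σ i).1) := by omega
        rw [if_neg h4, if_pos h3]
        simp [h1, h2]
      · have h3 : ¬ x.1 = (σ i).1 := by omega
        have h4 : (x.1 - 1 = (σ i).1) := by omega
        rw [if_pos h4, if_neg h3]
        simp [h1, h2]
    · have h3 : ¬ x.1 = (σ i).1 := by omega
      have h4 : ¬ (x.1 - 1 = (σ i).1) := by omega
      simp [h1, h3, h4]
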